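/- arXiv:1411.6813 — 4 statements merged into one kernel-verified Lean document; each statement's English description precedes it below -/
import Mathlib

section
/- Let γ = (a b; c d) ∈ SL(2,ℝ) with a² + c² = 1 and γ·i ≠ i. Set v = ab + cd. Then for every z in the upper half-plane ℍ², ρ(z, i) = ρ(z, γ⁻¹·i) if and only if v·Re(z) + v²/2 = 0. In other words, the Poincaré bisector Σ_γ is the vertical line Re z = −v/2. -/
open UpperHalfPlane Matrix MatrixGroups Complex

/-- If the first column of `γ = (a b; c d) ∈ SL(2,ℝ)` is a unit vector, then
`γ⁻¹·i = -(ab + cd) + i`. -/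
theorem coe_inv_smul_I_of_unit_col {a b c d : ℝ} {γ : SL(2, ℝ)}
    (hγ : (γ : Matrix (Fin 2) (Fin 2) ℝ) = !![a, b; c, d]) (h1 : a ^ 2 + c ^ 2 = 1) :
    ((γ⁻¹ • UpperHalfPlane.I : ℍ) : ℂ) = ⟨-(a * b + c * d), 1⟩ := by
  have hdet : a * d - b * c = 1 := by
    simpa [hγ, Matrix.det_fin_two_of] using γ.det_coe
  have hne : -(c : ℂ) * Complex.I + a ≠ 0 := by
    intro h
    have hre := congrArg Complex.re h
    have him := congrArg Complex.im h
    simp at hre him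
    simp [hre, him] at h1
  rw [UpperHalfPlane.coe_specialLinearGroup_apply]
  simp only [Matrix.SpecialLinearGroup.coe_inv, hγ, Matrix.adjugate_fin_two_of,
    Matrix.of_apply, Matrix.cons_val', Matrix.cons_val_zero, Matrix.cons_val_one,
    Matrix.cons_val_fin_one, Algebra.algebraMap_self, RingHom.id_apply,
    UpperHalfPlane.coe_I, Complex.ofReal_neg]
  rw [div_eq_iff hne]
  apply Complex.ext
  · simp
    linear_combination b * h1 + c * hdet
  · simp
    linear_combination a * hdet - d * h1

/-- Points of equal height are compared in `ℍ` by their Euclidean distances. -/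
theorem UpperHalfPlane.dist_eq_dist_iff_of_im_eq {z w w' : ℍ} (h : w.im = w'.im) :
    dist z w = dist z w' ↔ dist (z : ℂ) w ^ 2 = dist (z : ℂ) w' ^ 2 := by
  have hpos : 2 * z.im * w'.im ≠ 0 := by
    have := z.im_pos
    have := w'.im_pos
    positivity
  rw [← Real.cosh_injOn.eq_iff (Set.mem_Ici.2 dist_nonneg) (Set.mem_Ici.2 dist_nonneg),
    UpperHalfPlane.cosh_dist, UpperHalfPlane.cosh_dist, h, add_right_inj, div_left_inj' hpos]

/-- For `γ = (a b; c d) ∈ SL(2,ℝ)` with `a² + c² = 1` and `γ·i ≠ i`,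
setting `v = ab + cd`, the Poincaré bisector `{z : ρ(z,i) = ρ(z,γ⁻¹·i)}` is the
vertical line `v·Re z + v²/2 = 0`, i.e. `Re z = −v/2`. -/
theorem stmt1 (a b c d : ℝ) (γ : SL(2, ℝ))
    (hγ : (γ : Matrix (Fin 2) (Fin 2) ℝ) = !![a, b; c, d])
    (h1 : a ^ 2 + c ^ 2 = 1)
    (hfix : γ • UpperHalfPlane.I ≠ UpperHalfPlane.I)
    (v : ℝ) (hv : v = a * b + c * d) :
    ∀ z : ℍ,
      dist z UpperHalfPlane.I = dist z (γ⁻¹ • UpperHalfPlane.I) ↔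
        v * (z : ℂ).re + v ^ 2 / 2 = 0 := by
  intro z
  have hw := coe_inv_smul_I_of_unit_col hγ h1
  have him : UpperHalfPlane.I.im = (γ⁻¹ • UpperHalfPlane.I).im := by
    rw [← UpperHalfPlane.coe_im, ← UpperHalfPlane.coe_im, hw, UpperHalfPlane.coe_I, Complex.I_im]
  rw [UpperHalfPlane.dist_eq_dist_iff_of_im_eq him, hw, ← hv, UpperHalfPlane.coe_I,
    Complex.dist_eq, Complex.dist_eq, Complex.sq_norm, Complex.sq_norm, Complex.normSq_apply,
    Complex.normSq_apply]
  simp only [Complex.sub_re, Complex.sub_im, Complex.I_re, Complex.I_im]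
  constructor <;> intro h <;> linarith
end

section
/- Let γ = (a b; c d) ∈ SL(2,ℝ) with γ·i ≠ i. Then a = d if and only if for every t > 0, every point of the Poincaré bisector Σ_γ is equidistant from t·i and γ⁻¹·(t·i); that is, a = d if and only if for all t > 0 and all u ∈ ℍ², ρ(u, i) = ρ(u, γ⁻¹·i) implies ρ(u, t·i) = ρ(u, γ⁻¹·(t·i)). (Equivalently, Σ_γ is the bisector of the geodesic linking t·i and γ⁻¹·(t·i) for all t > 0.) -/
open UpperHalfPlane Matrix MatrixGroups Complex

/-- For `v = t·i`, a point `u` is equidistant from `v` and `γ⁻¹·v` iff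
`|u|² + t² = |au + b|² + t²|cu + d|²`. -/
lemma dist_eq_dist_inv_smul_iff {a b c d : ℝ} {γ : SL(2, ℝ)}
    (hγ : (γ : Matrix (Fin 2) (Fin 2) ℝ) = !![a, b; c, d]) (u v : ℍ) (hv : v.re = 0) :
    dist u v = dist u (γ⁻¹ • v) ↔
      u.re ^ 2 + u.im ^ 2 + v.im ^ 2 =
        (a * u.re + b) ^ 2 + a ^ 2 * u.im ^ 2 +
          v.im ^ 2 * ((c * u.re + d) ^ 2 + c ^ 2 * u.im ^ 2) := by
  have hdet : a * d - b * c = 1 := by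
    have := γ.det_coe
    rwa [hγ, Matrix.det_fin_two_of] at this
  have hinv : dist u (γ⁻¹ • v) = dist (γ • u) v := by
    rw [← dist_smul γ u, smul_inv_smul]
  have h00 : γ 0 0 = a := by simp [hγ]
  have h01 : γ 0 1 = b := by simp [hγ]
  have h10 : γ 1 0 = c := by simp [hγ]
  have h11 : γ 1 1 = d := by simp [hγ]
  have hy := u.im_pos
  have ht := v.im_pos
  have hq := (γ • u).im_pos
  have hN : 0 < (c * u.re + d) ^ 2 + c ^ 2 * u.im ^ 2 := by
    by_cases hc : c = 0
    · have : d ≠ 0 := by rintro rfl; simp [hc] at hdet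
      subst hc
      simpa using by positivity
    · positivity
  have hden : ((c : ℂ) * u + d) ≠ 0 := by
    intro h
    have h1 := congrArg Complex.re h
    have h2 := congrArg Complex.im h
    simp at h1 h2
    rcases h2 with h2 | h2
    · simp [h2] at h1; simp [h1, h2] at hdet
    · exact hy.ne' h2
  have hmul : ((γ • u : ℍ) : ℂ) * (c * u + d) = a * u + b := by
    rw [coe_specialLinearGroup_apply, h00, h01, h10, h11]
    exact div_mul_cancel₀ _ hden
  have hre := congrArg Complex.re hmul
  have him := congrArg Complex.im hmul
  simp at hre him
  rw [hinv, ← (Real.cosh_strictMonoOn.injOn).eq_iff dist_nonneg dist_nonneg,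
    UpperHalfPlane.cosh_dist', UpperHalfPlane.cosh_dist', hv]
  generalize (γ • u).re = p at *
  generalize (γ • u).im = q at *
  generalize u.re = x at *
  generalize u.im = y at *
  generalize v.im = t at *
  have hqN : q * ((c * x + d) ^ 2 + c ^ 2 * y ^ 2) = y := by
    linear_combination (c * x + d) * him - c * y * hre + y * hdet
  have hnorm : (p ^ 2 + q ^ 2) * ((c * x + d) ^ 2 + c ^ 2 * y ^ 2) =
      (a * x + b) ^ 2 + a ^ 2 * y ^ 2 := by
    linear_combination (p * (c * x + d) - q * (c * y) + (a * x + b)) * hre +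
      (p * (c * y) + q * (c * x + d) + a * y) * him
  generalize (c * x + d) ^ 2 + c ^ 2 * y ^ 2 = N at *
  rw [← hnorm, div_eq_div_iff (by positivity) (by positivity), ← hqN]
  have hk : 2 * q * t ≠ 0 := by positivity
  constructor
  · intro h
    apply mul_right_cancel₀ hk
    linear_combination h
  · intro h
    linear_combination (2 * q * t) * h

/-- A geodesic `P|u|² + 2Q·Re u + R = 0` with positive discriminant has two distinct points. -/
lemma exists_two_points_of_discrim_pos {P Q R : ℝ} (h : 0 < Q ^ 2 - P * R) :
    ∃ x₁ y₁ x₂ y₂ : ℝ, 0 < y₁ ∧ 0 < y₂ ∧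
      P * (x₁ ^ 2 + y₁ ^ 2) + 2 * Q * x₁ + R = 0 ∧
      P * (x₂ ^ 2 + y₂ ^ 2) + 2 * Q * x₂ + R = 0 ∧
      (x₁ ≠ x₂ ∨ x₁ ^ 2 + y₁ ^ 2 ≠ x₂ ^ 2 + y₂ ^ 2) := by
  by_cases hP : P = 0
  · subst hP
    have hQ : Q ≠ 0 := by rintro rfl; simp at h
    refine ⟨-R / (2 * Q), 1, -R / (2 * Q), 2, by norm_num, by norm_num, ?_, ?_, Or.inr ?_⟩
    · field_simp; ring
    · field_simp; ring
    · intro heq; linarith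
  · have hD := Real.sq_sqrt h.le
    have hDpos := Real.sqrt_pos.mpr h
    have hPpos : 0 < |P| := abs_pos.mpr hP
    set D := √(Q ^ 2 - P * R)
    have hP2 : |P| ^ 2 = P ^ 2 := sq_abs P
    refine ⟨-Q / P, D / |P|, (-Q + 3 / 5 * D) / P, 4 / 5 * D / |P|, by positivity, by positivity,
      ?_, ?_, Or.inl ?_⟩
    · rw [div_pow D, hP2, hD]; field_simp; ring
    · rw [div_pow (4 / 5 * D), hP2, mul_pow, hD]
      field_simp
      linear_combination 9 * hD
    · intro heq
      rw [div_left_inj' hP] at heq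
      linarith

/-- If `γ` does not fix `i`, then `a ≠ d` or `b ≠ -c`, so `(a - d)² + (b + c)²` is positive. -/
lemma sq_add_sq_pos_of_smul_I_ne {a b c d : ℝ} {γ : SL(2, ℝ)}
    (hγ : (γ : Matrix (Fin 2) (Fin 2) ℝ) = !![a, b; c, d])
    (hfix : γ • UpperHalfPlane.I ≠ UpperHalfPlane.I) :
    0 < (a - d) ^ 2 + (b + c) ^ 2 := by
  by_contra hle
  have had : a = d := by nlinarith [sq_nonneg (a - d), sq_nonneg (b + c)]
  have hbc : b = -c := by nlinarith [sq_nonneg (a - d), sq_nonneg (b + c)]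
  subst had hbc
  have hdet : a * a - -c * c = 1 := by
    have := γ.det_coe
    rwa [hγ, Matrix.det_fin_two_of] at this
  apply hfix
  ext
  rw [coe_specialLinearGroup_apply]
  have hden : ((c : ℂ) * Complex.I + a) ≠ 0 := by
    intro h
    have h1 := congrArg Complex.re h
    have h2 := congrArg Complex.im h
    simp at h1 h2
    simp [h1, h2] at hdet
  simp only [hγ, UpperHalfPlane.coe_I]
  simp
  rw [div_eq_iff hden]
  linear_combination (-(c : ℂ)) * Complex.I_sq

/-- For `γ = (a b; c d) ∈ SL(2,ℝ)` with `γ·i ≠ i`: `a = d` iff, for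
every `t > 0`, every point of the Poincaré bisector `Σ_γ` is equidistant from
`t·i` and `γ⁻¹·(t·i)`. -/
theorem stmt6 (a b c d : ℝ) (γ : SL(2, ℝ))
    (hγ : (γ : Matrix (Fin 2) (Fin 2) ℝ) = !![a, b; c, d])
    (hfix : γ • UpperHalfPlane.I ≠ UpperHalfPlane.I) :
    a = d ↔
      ∀ (t : ℝ) (ht : 0 < t), ∀ u : ℍ,
        dist u UpperHalfPlane.I = dist u (γ⁻¹ • UpperHalfPlane.I) →
          dist u (UpperHalfPlane.mk ((t : ℂ) * Complex.I) (by simpa using ht)) =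
            dist u (γ⁻¹ • (UpperHalfPlane.mk ((t : ℂ) * Complex.I) (by simpa using ht))) := by
  have hdet : a * d - b * c = 1 := by
    have := γ.det_coe
    rwa [hγ, Matrix.det_fin_two_of] at this
  have hpos := sq_add_sq_pos_of_smul_I_ne hγ hfix
  constructor
  · rintro rfl t ht u h
    rw [dist_eq_dist_inv_smul_iff hγ _ _ (by simp)] at h
    rw [dist_eq_dist_inv_smul_iff hγ _ _ (by simp [UpperHalfPlane.re])]
    have him : (UpperHalfPlane.mk ((t : ℂ) * Complex.I) (by simpa using ht)).im = t := by
      simp [UpperHalfPlane.im]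
    rw [him]
    rw [UpperHalfPlane.I_im] at h
    have hbc : b + c ≠ 0 := by
      intro h0
      simp [h0] at hpos
    have hgeod : c * (u.re ^ 2 + u.im ^ 2) + 2 * a * u.re + b = 0 := by
      apply mul_left_cancel₀ hbc
      linear_combination -h - (u.re ^ 2 + u.im ^ 2 + 1) * hdet
    linear_combination -(b + t ^ 2 * c) * hgeod - (u.re ^ 2 + u.im ^ 2 + t ^ 2) * hdet
  · intro H
    have hvanish : ∀ x y : ℝ, 0 < y →
        (a ^ 2 + c ^ 2 - 1) * (x ^ 2 + y ^ 2) + 2 * (a * b + c * d) * x + (b ^ 2 + d ^ 2 - 1) = 0 →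
        (a ^ 2 - 1) * (x ^ 2 + y ^ 2) + 2 * (a * b) * x + b ^ 2 = 0 ∧
          c ^ 2 * (x ^ 2 + y ^ 2) + 2 * (c * d) * x + d ^ 2 - 1 = 0 := by
      intro x y hy h
      have h2 := H 2 two_pos (UpperHalfPlane.mk ⟨x, y⟩ hy)
      rw [dist_eq_dist_inv_smul_iff hγ _ _ (by simp),
        dist_eq_dist_inv_smul_iff hγ _ _ (by simp [UpperHalfPlane.re])] at h2
      simp [UpperHalfPlane.re, UpperHalfPlane.im] at h2
      have h3 := h2 (by linear_combination -h)
      constructor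
      · linear_combination (1 / 3) * h3 + (4 / 3) * h
      · linear_combination (-1 / 3) * h3 - (1 / 3) * h
    obtain ⟨x₁, y₁, x₂, y₂, hy₁, hy₂, h₁, h₂, hne⟩ :=
      exists_two_points_of_discrim_pos (P := a ^ 2 + c ^ 2 - 1) (Q := a * b + c * d)
        (R := b ^ 2 + d ^ 2 - 1) (by
          have : (a * b + c * d) ^ 2 - (a ^ 2 + c ^ 2 - 1) * (b ^ 2 + d ^ 2 - 1) =
              (a - d) ^ 2 + (b + c) ^ 2 := by
            linear_combination (-(a * d - b * c) + 1) * hdet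
          rwa [this])
    obtain ⟨hA₁, hC₁⟩ := hvanish x₁ y₁ hy₁ h₁
    obtain ⟨hA₂, hC₂⟩ := hvanish x₂ y₂ hy₂ h₂
    by_cases hc : c = 0
    · subst hc
      have hd : d ≠ 0 := by rintro rfl; simp at hdet
      apply mul_right_cancel₀ hd
      linear_combination hdet - hC₁
    · apply mul_left_cancel₀ hc
      rcases hne with hne | hne
      · apply mul_right_cancel₀ (sub_ne_zero.mpr hne)
        linear_combination (-c ^ 2 / 2) * (hA₁ - hA₂) + ((a ^ 2 - 1) / 2) * (hC₁ - hC₂) -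
          c * a * (x₁ - x₂) * hdet
      · apply mul_right_cancel₀ (sub_ne_zero.mpr hne)
        linear_combination (c * d) * (hA₁ - hA₂) - (a * b) * (hC₁ - hC₂) -
          c * a * (x₁ ^ 2 + y₁ ^ 2 - (x₂ ^ 2 + y₂ ^ 2)) * hdet
end

section
/- Let γ = (a b; c d) ∈ SL(2,ℝ) with γ·i ≠ i. Then a = d if and only if there exists t₀ > 0 with t₀ ≠ 1 such that every point of the Poincaré bisector Σ_γ is equidistant from t₀·i and γ⁻¹·(t₀·i); that is, a = d if and only if there exists t₀ > 0, t₀ ≠ 1, such that for all u ∈ ℍ², ρ(u, i) = ρ(u, γ⁻¹·i) implies ρ(u, t₀·i) = ρ(u, γ⁻¹·(t₀·i)). -/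
open UpperHalfPlane Matrix MatrixGroups Complex

/-- The hyperbolic distance from `z` to the point `t·i` of the imaginary axis. -/
lemma cosh_dist_mul_I (z : ℍ) {t : ℝ} (ht : 0 < t) (h : 0 < ((t : ℂ) * Complex.I).im) :
    Real.cosh (dist z (UpperHalfPlane.mk ((t : ℂ) * Complex.I) h)) =
      (Complex.normSq z + t ^ 2) / (2 * z.im * t) := by
  have hz := z.im_pos
  rw [UpperHalfPlane.cosh_dist, Complex.dist_eq, ← Complex.normSq_eq_norm_sq,
    Complex.normSq_apply, Complex.normSq_apply]
  have h1 : (UpperHalfPlane.mk ((t : ℂ) * Complex.I) h).im = t := by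
    simp [UpperHalfPlane.im]
  rw [h1]
  simp only [Complex.sub_re, Complex.sub_im, Complex.re_ofReal_mul, Complex.im_ofReal_mul,
    Complex.I_re, Complex.I_im, UpperHalfPlane.coe_re, UpperHalfPlane.coe_im]
  field_simp
  ring

/-- The points equidistant from `t·i` and `γ⁻¹·(t·i)` are cut out by a polynomial equation. -/
lemma dist_mul_I_eq_dist_inv_smul_iff {a b c d : ℝ} {γ : SL(2, ℝ)}
    (hγ : (γ : Matrix (Fin 2) (Fin 2) ℝ) = !![a, b; c, d]) (u : ℍ) {t : ℝ} (ht : 0 < t)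
    (h : 0 < ((t : ℂ) * Complex.I).im) :
    dist u (UpperHalfPlane.mk ((t : ℂ) * Complex.I) h) =
        dist u (γ⁻¹ • UpperHalfPlane.mk ((t : ℂ) * Complex.I) h) ↔
      u.re ^ 2 + u.im ^ 2 + t ^ 2 = (a * u.re + b) ^ 2 + (a * u.im) ^ 2 +
        t ^ 2 * ((c * u.re + d) ^ 2 + (c * u.im) ^ 2) := by
  have hsmul : dist u (γ⁻¹ • UpperHalfPlane.mk ((t : ℂ) * Complex.I) h) =
      dist (γ • u) (UpperHalfPlane.mk ((t : ℂ) * Complex.I) h) := by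
    rw [← dist_smul γ u, smul_inv_smul]
  have hden : UpperHalfPlane.denom γ u = c * (u : ℂ) + d := by
    simp [UpperHalfPlane.denom, hγ]
  have hcoe : ((γ • u : ℍ) : ℂ) = (a * (u : ℂ) + b) / (c * (u : ℂ) + d) := by
    rw [UpperHalfPlane.coe_specialLinearGroup_apply]
    simp [hγ]
  have him : (γ • u).im = u.im / Complex.normSq (c * (u : ℂ) + d) := by
    have hGL : γ • u = (γ : GL (Fin 2) ℝ) • u := by
      rw [MulAction.compHom_smul_def]
      congr 1
    rw [← hden, hGL]
    simpa using UpperHalfPlane.im_smul_eq_div_normSq (γ : GL (Fin 2) ℝ) u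
  have hpos : 0 < Complex.normSq (c * (u : ℂ) + d) := by
    rw [← hden]
    exact UpperHalfPlane.normSq_denom_pos _ u.im_ne_zero
  have hnum : Complex.normSq (a * (u : ℂ) + b) = (a * u.re + b) ^ 2 + (a * u.im) ^ 2 := by
    simp [Complex.normSq_apply]; ring
  have hden' : Complex.normSq (c * (u : ℂ) + d) = (c * u.re + d) ^ 2 + (c * u.im) ^ 2 := by
    simp [Complex.normSq_apply]; ring
  have hu : Complex.normSq (u : ℂ) = u.re ^ 2 + u.im ^ 2 := by
    simp [Complex.normSq_apply]; ring
  have hy := u.im_pos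
  rw [hsmul, ← Real.cosh_strictMonoOn.injOn.eq_iff (Set.mem_Ici.2 dist_nonneg)
    (Set.mem_Ici.2 dist_nonneg), cosh_dist_mul_I _ ht, cosh_dist_mul_I _ ht, hcoe, him,
    Complex.normSq_div, ← hu, ← hnum, ← hden']
  generalize Complex.normSq (c * (u : ℂ) + d) = D at *
  have hrhs : (Complex.normSq (a * (u : ℂ) + b) / D + t ^ 2) / (2 * (u.im / D) * t) =
      (Complex.normSq (a * (u : ℂ) + b) + t ^ 2 * D) / (2 * u.im * t) := by
    field_simp
  rw [hrhs, div_left_inj' (by positivity)]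

/-- If a matrix of determinant one does not come from a rotation about `i`, and the equation
`|c u + d|² = 1` holds along its bisector, then its diagonal entries agree. -/
lemma diag_eq_of_forall_bisector {a b c d : ℝ} (hdet : a * d - b * c = 1)
    (hne : a ≠ d ∨ b + c ≠ 0)
    (h : ∀ x y : ℝ, 0 < y →
      x ^ 2 + y ^ 2 + 1 = (a * x + b) ^ 2 + (a * y) ^ 2 + ((c * x + d) ^ 2 + (c * y) ^ 2) →
      (c * x + d) ^ 2 + (c * y) ^ 2 = 1) : a = d := by
  suffices hminor : (1 - a ^ 2) * (1 - d ^ 2) = b ^ 2 * c ^ 2 by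
    have : (a - d) ^ 2 = 0 := by
      linear_combination -hminor + (a * d + b * c - 1) * hdet
    linarith [pow_eq_zero_iff (two_ne_zero) |>.1 this]
  set A := 1 - a ^ 2 - c ^ 2 with hA
  set B := a * b + c * d with hB
  set C := 1 - b ^ 2 - d ^ 2 with hC
  have hdisc : 0 < B ^ 2 - A * C := by
    have hid : B ^ 2 - A * C = (a - d) ^ 2 + (b + c) ^ 2 := by
      rw [hA, hB, hC]
      linear_combination (-(a * d - b * c) + 1) * hdet
    rw [hid]
    rcases hne with hne | hne
    · have := sub_ne_zero.2 hne
      positivity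
    · positivity
  by_cases hA0 : A = 0
  · have hB0 : B ≠ 0 := by
      rintro hB0
      simp [hA0, hB0] at hdisc
    have hline : ∀ y : ℝ, 0 < y →
        (c * (C / (2 * B)) + d) ^ 2 + (c * y) ^ 2 = 1 := by
      intro y hy
      refine h _ _ hy ?_
      have hx : 2 * B * (C / (2 * B)) = C := by field_simp
      generalize C / (2 * B) = x at *
      rw [hB, hC] at hx
      rw [hA] at hA0
      linear_combination (x ^ 2 + y ^ 2) * hA0 - hx
    have h1 := hline 1 one_pos
    have h2 := hline 2 two_pos
    have hc : c ^ 2 = 0 := by linear_combination (h2 - h1) / 3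
    have ha : 1 - a ^ 2 = 0 := by rw [hA] at hA0; linear_combination hA0 + hc
    rw [ha, hc]; ring
  · set p := B / A with hp
    set R := (B ^ 2 - A * C) / A ^ 2 with hR
    have hRpos : 0 < R := by positivity
    have hpA : A * p = B := by rw [hp]; field_simp
    have hRA : A * (R - p ^ 2) = -C := by rw [hR, hp]; field_simp; ring
    have hcirc : ∀ x y : ℝ, 0 < y → (x - p) ^ 2 + y ^ 2 = R →
        (c * x + d) ^ 2 + (c * y) ^ 2 = 1 ∧ (a * x + b) ^ 2 + (a * y) ^ 2 = x ^ 2 + y ^ 2 := by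
      intro x y hy hxy
      have hE : x ^ 2 + y ^ 2 + 1 =
          (a * x + b) ^ 2 + (a * y) ^ 2 + ((c * x + d) ^ 2 + (c * y) ^ 2) := by
        rw [hA, hB] at hpA
        rw [hA, hC] at hRA
        linear_combination (1 - a ^ 2 - c ^ 2) * hxy + 2 * x * hpA + hRA
      have h1 := h x y hy hE
      exact ⟨h1, by linarith⟩
    set s := √R / 2 with hs
    have hspos : 0 < s := by positivity
    have hsR : 4 * s ^ 2 = R := by
      rw [hs, div_pow, Real.sq_sqrt hRpos.le]; ring
    have hy : 0 < √3 * s := by positivity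
    have hy2 : (√3 * s) ^ 2 = 3 * s ^ 2 := by
      rw [mul_pow, Real.sq_sqrt (by norm_num)]
    obtain ⟨hc₁, ha₁⟩ := hcirc (p + s) (√3 * s) hy (by linear_combination hy2 + hsR)
    obtain ⟨hc₂, ha₂⟩ := hcirc (p - s) (√3 * s) hy (by linear_combination hy2 + hsR)
    generalize √3 * s = y at *
    have hap : (1 - a ^ 2) * p = a * b := by
      refine mul_left_cancel₀ hspos.ne' ?_
      linear_combination (ha₂ - ha₁) / 4
    have hcp : c ^ 2 * p = -(c * d) := by
      refine mul_left_cancel₀ hspos.ne' ?_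
      linear_combination (hc₁ - hc₂) / 4
    have haR : (1 - a ^ 2) * (R - p ^ 2) = b ^ 2 := by
      linear_combination -(ha₁ + ha₂) / 2 - 2 * p * hap - (1 - a ^ 2) * (hy2 + hsR)
    have hcR : c ^ 2 * (R - p ^ 2) = 1 - d ^ 2 := by
      linear_combination (hc₁ + hc₂) / 2 - 2 * p * hcp - c ^ 2 * (hy2 + hsR)
    linear_combination c ^ 2 * haR - (1 - a ^ 2) * hcR

/-- For `γ = (a b; c d) ∈ SL(2,ℝ)` with `γ·i ≠ i`: `a = d` iff there
exists `t₀ > 0`, `t₀ ≠ 1`, such that every point of the Poincaré bisector `Σ_γ`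
is equidistant from `t₀·i` and `γ⁻¹·(t₀·i)`. -/
theorem stmt7 (a b c d : ℝ) (γ : SL(2, ℝ))
    (hγ : (γ : Matrix (Fin 2) (Fin 2) ℝ) = !![a, b; c, d])
    (hfix : γ • UpperHalfPlane.I ≠ UpperHalfPlane.I) :
    a = d ↔
      ∃ (t₀ : ℝ) (ht₀ : 0 < t₀), t₀ ≠ 1 ∧
        ∀ u : ℍ,
          dist u UpperHalfPlane.I = dist u (γ⁻¹ • UpperHalfPlane.I) →
            dist u (UpperHalfPlane.mk ((t₀ : ℂ) * Complex.I) (by simpa using ht₀)) =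
              dist u (γ⁻¹ • (UpperHalfPlane.mk ((t₀ : ℂ) * Complex.I) (by simpa using ht₀))) := by
  have hdet : a * d - b * c = 1 := by
    have := γ.det_coe
    rwa [hγ, Matrix.det_fin_two_of] at this
  have hI : UpperHalfPlane.I = UpperHalfPlane.mk (((1 : ℝ) : ℂ) * Complex.I) (by simp) := by
    ext; simp
  have hbis : ∀ u : ℍ, dist u UpperHalfPlane.I = dist u (γ⁻¹ • UpperHalfPlane.I) ↔
      u.re ^ 2 + u.im ^ 2 + 1 = (a * u.re + b) ^ 2 + (a * u.im) ^ 2 +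
        ((c * u.re + d) ^ 2 + (c * u.im) ^ 2) := by
    intro u
    rw [hI, dist_mul_I_eq_dist_inv_smul_iff hγ u one_pos]
    simp
  have hne : a ≠ d ∨ b + c ≠ 0 := by
    by_contra! hcon
    obtain ⟨rfl, hbc⟩ := hcon
    obtain rfl : c = -b := by linarith
    apply hfix
    have hzero : dist UpperHalfPlane.I (γ⁻¹ • UpperHalfPlane.I) = 0 := by
      rw [← (hbis UpperHalfPlane.I).2 (by simp; linear_combination -2 * hdet), dist_self]
    rw [smul_eq_iff_eq_inv_smul]
    exact dist_eq_zero.1 hzero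
  constructor
  · rintro rfl
    refine ⟨2, two_pos, by norm_num, fun u hu ↦ ?_⟩
    rw [hbis] at hu
    rw [dist_mul_I_eq_dist_inv_smul_iff hγ u two_pos]
    have hbc : b + c ≠ 0 := by simpa using hne
    have hline : c * (u.re ^ 2 + u.im ^ 2) + 2 * a * u.re + b = 0 := by
      refine mul_left_cancel₀ hbc ?_
      linear_combination -hu - (u.re ^ 2 + u.im ^ 2 + 1) * hdet
    linear_combination -(b + 4 * c) * hline - (u.re ^ 2 + u.im ^ 2 + 4) * hdet
  · rintro ⟨t, ht, ht1, H⟩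
    refine diag_eq_of_forall_bisector hdet hne fun x y hy hxy ↦ ?_
    have hxt := (dist_mul_I_eq_dist_inv_smul_iff hγ (UpperHalfPlane.mk ⟨x, y⟩ hy) ht _).1
      (H _ ((hbis (UpperHalfPlane.mk ⟨x, y⟩ hy)).2 hxy))
    change x ^ 2 + y ^ 2 + t ^ 2 = (a * x + b) ^ 2 + (a * y) ^ 2 +
        t ^ 2 * ((c * x + d) ^ 2 + (c * y) ^ 2) at hxt
    have ht2 : t ^ 2 - 1 ≠ 0 := by
      rwa [sub_ne_zero, Ne, pow_eq_one_iff_of_nonneg ht.le two_ne_zero]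
    refine mul_left_cancel₀ ht2 ?_
    linear_combination hxy - hxt
end

section
/- Let a, b, c ∈ ℂ with c ≠ 0 and a·conj(a) − b·c = 1 (so the matrix (a b; c conj(a)) lies in SL(2,ℂ)). Let w ∈ ℂ with conj(c)·conj(w) + a ≠ 0, and set s = −conj(a)/c + 1/(c·(conj(c)·conj(w) + a)), which is the image of w under the inversion in the circle of center −conj(a)/c and radius 1/|c|. Then c·s + conj(a) ≠ 0 and (a·s + b)/(c·s + conj(a)) = −(conj(c)/c)·conj(w). In particular, if c is real then the Möbius transformation of (a b; c conj(a)) composed with this inversion is the map w ↦ −conj(w) (reflection in the imaginary axis), and if c is purely imaginary it is the map w ↦ conj(w) (reflection in the real axis). -/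
open Complex

/-- Let `a, b, c ∈ ℂ`, `c ≠ 0`, `a·conj a − b·c = 1`, and `w ∈ ℂ`
with `conj c·conj w + a ≠ 0`. With `s = −conj a/c + 1/(c·(conj c·conj w + a))`
(the image of `w` under the inversion in the circle of center `−conj a/c` and
radius `1/|c|`), one has `c·s + conj a ≠ 0` and
`(a·s + b)/(c·s + conj a) = −(conj c/c)·conj w`. In particular if `c` is real the
composition is `w ↦ −conj w`, and if `c` is purely imaginary it is `w ↦ conj w`. -/
theorem stmt13 (a b c w : ℂ) (hc : c ≠ 0)
    (hdet : a * (starRingEnd ℂ) a - b * c = 1)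
    (hw : (starRingEnd ℂ) c * (starRingEnd ℂ) w + a ≠ 0)
    (s : ℂ)
    (hs : s = -(starRingEnd ℂ) a / c +
      1 / (c * ((starRingEnd ℂ) c * (starRingEnd ℂ) w + a))) :
    c * s + (starRingEnd ℂ) a ≠ 0 ∧
      (a * s + b) / (c * s + (starRingEnd ℂ) a) =
        -((starRingEnd ℂ) c / c) * (starRingEnd ℂ) w ∧
      (c.im = 0 →
        (a * s + b) / (c * s + (starRingEnd ℂ) a) = -(starRingEnd ℂ) w) ∧
      (c.re = 0 →
        (a * s + b) / (c * s + (starRingEnd ℂ) a) = (starRingEnd ℂ) w) := by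
  have hden : c * s + (starRingEnd ℂ) a =
      1 / ((starRingEnd ℂ) c * (starRingEnd ℂ) w + a) := by
    rw [hs]
    field_simp
    ring
  have hnum : a * s + b = -((starRingEnd ℂ) c / c) * (starRingEnd ℂ) w *
      (1 / ((starRingEnd ℂ) c * (starRingEnd ℂ) w + a)) := by
    rw [hs]
    field_simp
    linear_combination (-((starRingEnd ℂ) c * (starRingEnd ℂ) w + a)) * hdet
  have hne : c * s + (starRingEnd ℂ) a ≠ 0 := by
    rw [hden]
    exact one_div_ne_zero hw
  have hquot : (a * s + b) / (c * s + (starRingEnd ℂ) a) =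
      -((starRingEnd ℂ) c / c) * (starRingEnd ℂ) w := by
    rw [div_eq_iff hne, hnum, hden]
  refine ⟨hne, hquot, fun him => ?_, fun hre => ?_⟩
  · rw [hquot, conj_eq_iff_im.mpr him, div_self hc, neg_one_mul]
  · have hconj : (starRingEnd ℂ) c = -c := by
      apply Complex.ext <;> simp [hre]
    rw [hquot, hconj, neg_div, div_self hc, neg_neg, one_mul]
end
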